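/- Let λ be a character of B. Then for every e ∈ B with λ(e) = true and every r ∈ R, both er − r ∈ I_λ and re − r ∈ I_λ; consequently the quotient ring R/I_λ is a unital ring whose multiplicative identity is the class e + I_λ (which does not depend on the choice of e ∈ B with λ(e) = true). -/

import Mathlib

/-- `B` is a set of central idempotents of the (possibly non-unital, non-commutative)
ring `R` containing `0`, closed under the generalized Boolean algebra operations
`e ⊓ f = e*f`, `e ⊔ f = e + f - e*f`, `e \ f = e - e*f`, and forming a set of
local units for `R`. -/
structure CentralUnits (R : Type*) [NonUnitalRing R] (B : Set R) : Prop where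
  zero_mem : (0 : R) ∈ B
  idem : ∀ e ∈ B, e * e = e
  central : ∀ e ∈ B, ∀ r : R, e * r = r * e
  inf_mem : ∀ e ∈ B, ∀ f ∈ B, e * f ∈ B
  sup_mem : ∀ e ∈ B, ∀ f ∈ B, e + f - e * f ∈ B
  sdiff_mem : ∀ e ∈ B, ∀ f ∈ B, e - e * f ∈ B
  localUnits : ∀ r : R, ∃ e ∈ B, e * r = r ∧ r * e = r

/-- A character of the generalized Boolean algebra `B` (of central idempotents of `R`,
with `e ⊓ f = e*f`, `e ⊔ f = e + f - e*f`, `e \ f = e - e*f` and `⊥ = 0`): a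
`Bool`-valued map, not identically `false` on `B`, preserving `⊥`, joins, meets and
relative complements of elements of `B`. -/
def IsBChar {R : Type*} [NonUnitalRing R] (B : Set R) (l : R → Bool) : Prop :=
  (∃ e ∈ B, l e = true) ∧ l 0 = false ∧
  (∀ e ∈ B, ∀ f ∈ B, l (e + f - e * f) = (l e || l f)) ∧
  (∀ e ∈ B, ∀ f ∈ B, l (e * f) = (l e && l f)) ∧
  (∀ e ∈ B, ∀ f ∈ B, l (e - e * f) = (l e && !l f))

/-- The set `I_λ = {r ∈ R : e * r = 0 for some e ∈ B with λ(e) = true}`. -/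
def Ilam {R : Type*} [NonUnitalRing R] (B : Set R) (l : R → Bool) : Set R :=
  {r | ∃ e ∈ B, l e = true ∧ e * r = 0}

/-- For every `e ∈ B` with `λ(e) = true` and every `r ∈ R`, both `e*r - r` and
`r*e - r` lie in `I_λ`; consequently, the quotient ring `R/I_λ` is unital with
identity the class of `e`, which does not depend on the choice of `e`
(any two such `e, f` are congruent modulo `I_λ`). -/
theorem Ilam_quotient_unital {R : Type*} [NonUnitalRing R] (B : Set R)
    (hB : CentralUnits R B) (l : R → Bool) (hl : IsBChar B l) :
    ∀ e ∈ B, l e = true →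
      (∀ r : R, e * r - r ∈ Ilam B l ∧ r * e - r ∈ Ilam B l) ∧
      (∀ f ∈ B, l f = true → e - f ∈ Ilam B l) := by
  intro e he hle
  obtain ⟨-, -, -, hinf, -⟩ := hl
  refine ⟨fun r => ?_, fun f hf hlf => ⟨e * f, hB.inf_mem e he f hf, ?_, ?_⟩⟩
  · have h : e * (e * r - r) = 0 := by
      rw [mul_sub, ← mul_assoc, hB.idem e he, sub_self]
    exact ⟨⟨e, he, hle, h⟩, ⟨e, he, hle, by rwa [← hB.central e he r]⟩⟩
  · simp [hinf e he f hf, hle, hlf]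
  · rw [mul_sub, mul_assoc, ← hB.central e he f, ← mul_assoc, hB.idem e he, mul_assoc,
      hB.idem f hf, sub_self]
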